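/- Every orthomodular poset which is not a lattice has at least 18 elements. -/

import Mathlib

/-- An orthomodular poset structure on a bounded poset `P` with unary operation `neg`:
`neg` is an antitone involution which is a complementation, suprema of orthogonal pairs
exist, and the orthomodular law holds. -/
def IsOMP {P : Type*} [PartialOrder P] [BoundedOrder P] (neg : P → P) : Prop :=
  (∀ x : P, neg (neg x) = x) ∧
  (∀ x y : P, x ≤ y → neg y ≤ neg x) ∧
  (∀ x : P, IsGLB {x, neg x} ⊥ ∧ IsLUB {x, neg x} ⊤) ∧
  (∀ x y : P, x ≤ neg y → ∃ s, IsLUB {x, y} s) ∧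
  (∀ x y : P, x ≤ y → ∃ m, IsGLB {y, neg x} m ∧ IsLUB {x, m} y)

section OrthomodularPoset

variable {P : Type*} [PartialOrder P] [BoundedOrder P] {neg : P → P}

/-- `c` is the orthogonal sum of `a` and `p`. -/
structure IsOrthoSum (neg : P → P) (a p c : P) : Prop where
  left_le : a ≤ c
  right_le : p ≤ c
  orth : p ≤ neg a
  sup_le : ∀ x, a ≤ x → p ≤ x → c ≤ x
  le_right : ∀ x, x ≤ c → x ≤ neg a → x ≤ p
  le_left : ∀ x, x ≤ c → x ≤ neg p → x ≤ a

theorem IsOMP.eq_bot (h : IsOMP neg) {x y : P} (h₁ : x ≤ y) (h₂ : x ≤ neg y) : x = ⊥ :=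
  le_bot_iff.1 ((h.2.2.1 y).1.2 (by simp [lowerBounds, h₁, h₂]))

/-- Every element below `c` has a relative orthocomplement in `c`. -/
theorem IsOMP.exists_isOrthoSum (h : IsOMP neg) {a c : P} (hac : a ≤ c) :
    ∃ p, IsOrthoSum neg a p c := by
  obtain ⟨hinv, hanti, -, -, hom⟩ := id h
  obtain ⟨p, hp, hc⟩ := hom a c hac
  have hpc : p ≤ c := hp.1 (by simp)
  have hpa : p ≤ neg a := hp.1 (by simp)
  have hap : a ≤ neg p := by simpa [hinv] using hanti _ _ hpa
  have le_right : ∀ x, x ≤ c → x ≤ neg a → x ≤ p := fun x h₁ h₂ ↦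
    hp.2 (by simp [lowerBounds, h₁, h₂])
  refine ⟨p, hac, hpc, hpa, fun x h₁ h₂ ↦ hc.2 (by simp [upperBounds, h₁, h₂]), le_right, ?_⟩
  intro x hxc hxp
  obtain ⟨m, hm, -⟩ := hom p c hpc
  have hmc : m ≤ c := hm.1 (by simp)
  have hmp : m ≤ neg p := hm.1 (by simp)
  have ham : a ≤ m := hm.2 (by simp [lowerBounds, hac, hap])
  obtain ⟨n, hn, hm'⟩ := hom a m ham
  have hnm : n ≤ m := hn.1 (by simp)
  have hnp : n ≤ p := le_right n (hnm.trans hmc) (hn.1 (by simp))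
  have hn0 : n = ⊥ := h.eq_bot hnp (hnm.trans hmp)
  have hma : m ≤ a := hm'.2 (by simp [upperBounds, hn0])
  exact (hm.2 (by simp [lowerBounds, hxc, hxp])).trans hma

/-- Two elements `a`, `b` without a supremum, two incomparable upper bounds `c`, `d` of them,
and the relative orthocomplements of the former in the latter. -/
structure IsSupGap (neg : P → P) (a b c d p q r s : P) : Prop where
  no_sup : ¬ ∃ u, IsLUB {a, b} u
  not_le : ¬ c ≤ d
  not_ge : ¬ d ≤ c
  left_sum : IsOrthoSum neg a p c
  right_sum : IsOrthoSum neg b q c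
  left_sum' : IsOrthoSum neg a r d
  right_sum' : IsOrthoSum neg b s d

theorem IsSupGap.nodup (h : IsOMP neg) {a b c d p q r s : P}
    (H : IsSupGap neg a b c d p q r s) :
    ([⊥, a, b, neg c, neg d, p, q, r, s] ++
      [⊥, a, b, neg c, neg d, p, q, r, s].map neg).Nodup := by
  have hbot : ∀ x y : P, x ≤ y → x ≤ neg y → x = ⊥ := fun x y ↦ h.eq_bot
  obtain ⟨hinv, hanti, -, hsup, -⟩ := id h
  obtain ⟨h0, h1, h2, ⟨p1, p2, p3, p4, p5, p6⟩, ⟨q1, q2, q3, q4, q5, q6⟩,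
    ⟨r1, r2, r3, r4, r5, r6⟩, ⟨s1, s2, s3, s4, s5, s6⟩⟩ := H
  have hab : ¬ a ≤ b := fun h ↦ h0 ⟨b, by simp [h], by simp +contextual [lowerBounds]⟩
  have hba : ¬ b ≤ a := fun h ↦ h0 ⟨a, by simp [h], by simp +contextual [lowerBounds]⟩
  have hab' : ¬ a ≤ neg b := fun h ↦ h0 (hsup _ _ h)
  have hba' : ¬ b ≤ neg a := by grind
  have hle : ∀ x : P, ⊥ ≤ x := fun _ ↦ bot_le
  have htr : ∀ x y z : P, x ≤ y → y ≤ z → x ≤ z := fun _ _ _ ↦ le_trans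
  have hrefl : ∀ x : P, x ≤ x := fun _ ↦ le_rfl
  have htop : (⊥ : P) ≠ neg ⊥ := fun e ↦ hba <| by
    have := hanti ⊥ (neg b) bot_le
    rw [hinv, ← e] at this
    exact this.trans bot_le
  clear hsup
  have hnodup : [⊥, a, b, neg c, neg d, p, q, r, s].Nodup := by
    simp only [List.nodup_cons, List.mem_cons, not_or, List.not_mem_nil]
    refine ⟨⟨?_, ?_, ?_, ?_, ?_, ?_, ?_, ?_, ?_⟩, ⟨?_, ?_, ?_, ?_, ?_, ?_, ?_, ?_⟩,
      ⟨?_, ?_, ?_, ?_, ?_, ?_, ?_⟩, ⟨?_, ?_, ?_, ?_, ?_, ?_⟩, ⟨?_, ?_, ?_, ?_, ?_⟩,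
      ⟨?_, ?_, ?_, ?_⟩, ⟨?_, ?_, ?_⟩, ⟨?_, ?_⟩, ?_⟩ <;> grind
  refine List.Nodup.append hnodup
    (List.Nodup.map (Function.LeftInverse.injective hinv) hnodup) ?_
  rintro x hx hy
  simp only [List.map, List.mem_cons, List.not_mem_nil, or_false] at hx hy
  rcases hx with rfl | rfl | rfl | rfl | rfl | rfl | rfl | rfl | rfl <;>
    rcases hy with e | e | e | e | e | e | e | e | e <;> grind

/-- In a finite poset with top, elements without a supremum have incomparable upper bounds. -/
theorem exists_incomparable_upperBounds {P : Type*} [PartialOrder P] [OrderTop P] [Finite P]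
    {a b : P} (hab : ¬ ∃ u, IsLUB {a, b} u) :
    ∃ c d, (a ≤ c ∧ b ≤ c) ∧ (a ≤ d ∧ b ≤ d) ∧ ¬ c ≤ d ∧ ¬ d ≤ c := by
  obtain ⟨c, hc⟩ := (Set.toFinite {c : P | a ≤ c ∧ b ≤ c}).exists_minimal
    ⟨⊤, le_top, le_top⟩
  by_contra! hcon
  refine hab ⟨c, by simpa [upperBounds] using hc.prop, fun d hd ↦ ?_⟩
  have hd' : a ≤ d ∧ b ≤ d := by simpa [upperBounds] using hd
  by_contra hcd
  exact hcd (hc.le_of_le hd' (hcon c d hc.prop hd' hcd))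

theorem IsOMP.nonempty_embedding_of_no_sup (h : IsOMP neg) {a b : P}
    (hab : ¬ ∃ u, IsLUB {a, b} u) : Nonempty (Fin 18 ↪ P) := by
  cases finite_or_infinite P
  · obtain ⟨c, d, ⟨hac, hbc⟩, ⟨had, hbd⟩, hcd, hdc⟩ := exists_incomparable_upperBounds hab
    obtain ⟨p, hp⟩ := h.exists_isOrthoSum hac
    obtain ⟨q, hq⟩ := h.exists_isOrthoSum hbc
    obtain ⟨r, hr⟩ := h.exists_isOrthoSum had
    obtain ⟨s, hs⟩ := h.exists_isOrthoSum hbd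
    have hnodup := IsSupGap.nodup h ⟨hab, hcd, hdc, hp, hq, hr, hs⟩
    exact ⟨⟨_, List.nodup_iff_injective_get.1 hnodup⟩⟩
  · exact ⟨Fin.valEmbedding.trans (Infinite.natEmbedding P)⟩

theorem IsOMP.isGLB_of_isLUB_neg (h : IsOMP neg) {a b u : P} (hu : IsLUB {neg a, neg b} u) :
    IsGLB {a, b} (neg u) := by
  obtain ⟨hinv, hanti, -⟩ := h
  constructor
  · have h₁ := hanti _ _ (hu.1 (Set.mem_insert (neg a) {neg b}))
    have h₂ := hanti _ _ (hu.1 (Set.mem_insert_of_mem (neg a) (Set.mem_singleton (neg b))))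
    rw [hinv] at h₁ h₂
    simp [lowerBounds, h₁, h₂]
  · intro x hx
    have h₁ := hanti _ _ (hx (Set.mem_insert a {b}))
    have h₂ := hanti _ _ (hx (Set.mem_insert_of_mem a (Set.mem_singleton b)))
    have := hanti _ _ (hu.2 (show neg x ∈ _ by simp [upperBounds, h₁, h₂]))
    rwa [hinv] at this

end OrthomodularPoset

/-- Every orthomodular poset which is not a lattice has at least 18 elements. -/
theorem stmt3 {P : Type*} [PartialOrder P] [BoundedOrder P] (neg : P → P)
    (h : IsOMP neg)
    (hnl : ¬ ∀ a b : P, (∃ s, IsLUB {a, b} s) ∧ (∃ m, IsGLB {a, b} m)) :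
    Nonempty (Fin 18 ↪ P) := by
  by_contra hcon
  have hsup : ∀ a b : P, ∃ u, IsLUB {a, b} u := fun a b ↦ by
    by_contra hab
    exact hcon (h.nonempty_embedding_of_no_sup hab)
  refine hnl fun a b ↦ ⟨hsup a b, ?_⟩
  obtain ⟨u, hu⟩ := hsup (neg a) (neg b)
  exact ⟨neg u, h.isGLB_of_isLUB_neg hu⟩
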